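/- Let N ≥ 2 be fixed and let (n_i)_{i≥1} be integers with 2 ≤ n_i ≤ N. For each k, let n = Σ_{i=1}^k n_i, index the n positions lexicographically, and define symmetric weights η_rs = (n − n_i)/(n_i − 1) if positions r and s both belong to treatment i and η_rs = −1 otherwise, with M_n = Σ_{1≤r<s≤n} η_rs². Then, as k → ∞, Σ_{1≤i≠j<u≤n} η_iu² η_ju² / M_n² → 0 and Σ_{1≤i≠j≤n} η_ij⁴ / M_n² → 0. -/

import Mathlib

open Finset Filter
open scoped Topology

noncomputable section

/-- Cumulative sample sizes: `csum n i = n 0 + ⋯ + n (i-1)`, the number of positions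
preceding treatment `i` in the lexicographic ordering (so `csum n k` is the total `n`). -/
def csum (n : ℕ → ℕ) (i : ℕ) : ℕ := ∑ i' ∈ Finset.range i, n i'

/-- The treatment to which the lexicographic position `r` belongs: the unique `i` with
`csum n i ≤ r < csum n (i+1)`. -/
def trt (n : ℕ → ℕ) (r : ℕ) : ℕ := sInf {i : ℕ | r < csum n (i + 1)}

/-- The weights of representation (2.5): `η_{rs} = (n - n_i)/(n_i - 1)` if positions `r` and
`s` both belong to treatment `i`, and `η_{rs} = -1` otherwise. -/
def eta (n : ℕ → ℕ) (k : ℕ) (r s : ℕ) : ℝ :=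
  if trt n r = trt n s then
    ((csum n k : ℝ) - (n (trt n r) : ℝ)) / ((n (trt n r) : ℝ) - 1)
  else -1

/-- `M_n = Σ_{r<s} η_{rs}²`. -/
def Mwt (n : ℕ → ℕ) (k : ℕ) : ℝ :=
  ∑ r ∈ Finset.range (csum n k),
    ∑ s ∈ (Finset.range (csum n k)).filter (fun s => r < s), (eta n k r s) ^ 2

lemma csum_succ (n : ℕ → ℕ) (i : ℕ) : csum n (i + 1) = csum n i + n i := by
  simp [csum, Finset.sum_range_succ]

lemma csum_strictMono (n : ℕ → ℕ) (hn : ∀ i, 2 ≤ n i) : StrictMono (csum n) := by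
  apply strictMono_nat_of_lt_succ
  intro i
  have := hn i
  rw [csum_succ]; omega

lemma csum_ge (n : ℕ → ℕ) (hn : ∀ i, 2 ≤ n i) (k : ℕ) : k ≤ csum n k :=
  (csum_strictMono n hn).le_apply

lemma csum_le (N : ℕ) (n : ℕ → ℕ) (hn : ∀ i, n i ≤ N) (k : ℕ) : csum n k ≤ k * N := by
  have := Finset.sum_le_card_nsmul (Finset.range k) n N (fun i _ => hn i)
  simpa [csum] using this

lemma lt_csum_trt (n : ℕ → ℕ) (hn : ∀ i, 2 ≤ n i) (r : ℕ) : r < csum n (trt n r + 1) := by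
  have h : ({i : ℕ | r < csum n (i + 1)}).Nonempty := ⟨r, csum_ge n hn (r + 1)⟩
  exact Nat.sInf_mem h

lemma csum_trt_le (n : ℕ → ℕ) (r : ℕ) : csum n (trt n r) ≤ r := by
  by_contra h
  push Not at h
  rcases Nat.eq_zero_or_pos (trt n r) with h0 | h0
  · rw [h0] at h; simp [csum] at h
  · have h2 : trt n r ≤ trt n r - 1 := by
      apply Nat.sInf_le
      change r < csum n (trt n r - 1 + 1)
      rwa [Nat.sub_add_cancel h0]
    omega

lemma trt_eq (n : ℕ → ℕ) (hn : ∀ i, 2 ≤ n i) (r i : ℕ) (h1 : csum n i ≤ r)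
    (h2 : r < csum n (i + 1)) : trt n r = i := by
  have a := lt_csum_trt n hn r
  have b := csum_trt_le n r
  have c := (csum_strictMono n hn).lt_iff_lt.1 (lt_of_le_of_lt h1 a)
  have d := (csum_strictMono n hn).lt_iff_lt.1 (lt_of_le_of_lt b h2)
  omega

lemma eta_comm (n : ℕ → ℕ) (k r s : ℕ) : eta n k r s = eta n k s r := by
  unfold eta
  by_cases h : trt n r = trt n s
  · simp [h]
  · simp [h, Ne.symm h]

lemma eta_sq_le (n : ℕ → ℕ) (hn : ∀ i, 2 ≤ n i) (k i u : ℕ) (hu : u < csum n k) :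
    eta n k i u ^ 2 ≤ 1 + if trt n i = trt n u then (csum n k : ℝ) ^ 2 else 0 := by
  unfold eta
  split_ifs with h
  · rw [h]
    have ht : trt n u < k :=
      (csum_strictMono n hn).lt_iff_lt.1 (lt_of_le_of_lt (csum_trt_le n u) hu)
    have h1 : n (trt n u) ≤ csum n k :=
      Finset.single_le_sum (f := n) (fun _ _ => Nat.zero_le _) (Finset.mem_range.2 ht)
    have h1' : (n (trt n u) : ℝ) ≤ csum n k := by exact_mod_cast h1
    have h2 : (2 : ℝ) ≤ n (trt n u) := by exact_mod_cast hn (trt n u)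
    have h3 : ((csum n k : ℝ) - n (trt n u)) / ((n (trt n u) : ℝ) - 1) ≤ csum n k := by
      rw [div_le_iff₀ (by linarith)]
      nlinarith
    have h4 : 0 ≤ ((csum n k : ℝ) - n (trt n u)) / ((n (trt n u) : ℝ) - 1) :=
      div_nonneg (by linarith) (by linarith)
    nlinarith
  · norm_num

lemma sum_eta_sq_le (N : ℕ) (n : ℕ → ℕ) (hn : ∀ i, 2 ≤ n i ∧ n i ≤ N) (k u : ℕ)
    (hu : u < csum n k) :
    ∑ i ∈ Finset.range (csum n k), eta n k i u ^ 2 ≤ ((N : ℝ) + 1) * (csum n k : ℝ) ^ 2 := by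
  have hn2 : ∀ i, 2 ≤ n i := fun i => (hn i).1
  have hcard : ((Finset.range (csum n k)).filter (fun i => trt n i = trt n u)).card ≤ N := by
    calc _ ≤ (Finset.Ico (csum n (trt n u)) (csum n (trt n u + 1))).card := by
          apply Finset.card_le_card
          intro i hi
          have hi := (Finset.mem_filter.1 hi).2
          rw [Finset.mem_Ico, ← hi]
          exact ⟨csum_trt_le n i, lt_csum_trt n hn2 i⟩
      _ ≤ N := by
          have := (hn (trt n u)).2
          rw [Nat.card_Ico, csum_succ]; omega
  have hcard' : (((Finset.range (csum n k)).filter (fun i => trt n i = trt n u)).card : ℝ) ≤ N := by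
    exact_mod_cast hcard
  have h1 : (1 : ℝ) ≤ csum n k := by
    have : 1 ≤ csum n k := by omega
    exact_mod_cast this
  calc _ ≤ ∑ i ∈ Finset.range (csum n k),
        (1 + if trt n i = trt n u then (csum n k : ℝ) ^ 2 else 0) :=
        Finset.sum_le_sum fun i _ => eta_sq_le n hn2 k i u hu
    _ = csum n k + (((Finset.range (csum n k)).filter
          (fun i => trt n i = trt n u)).card : ℝ) * (csum n k : ℝ) ^ 2 := by
        rw [Finset.sum_add_distrib, ← Finset.sum_filter]
        simp
    _ ≤ _ := by
        nlinarith [mul_le_mul_of_nonneg_right hcard' (sq_nonneg (csum n k : ℝ))]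

lemma sum_sq_sum_le (N : ℕ) (n : ℕ → ℕ) (hn : ∀ i, 2 ≤ n i ∧ n i ≤ N) (k : ℕ) :
    ∑ u ∈ Finset.range (csum n k), (∑ i ∈ Finset.range (csum n k), eta n k i u ^ 2) ^ 2
      ≤ ((N : ℝ) + 1) ^ 2 * (csum n k : ℝ) ^ 5 := by
  calc _ ≤ ∑ u ∈ Finset.range (csum n k), (((N : ℝ) + 1) * (csum n k : ℝ) ^ 2) ^ 2 := by
        apply Finset.sum_le_sum
        intro u hu
        exact pow_le_pow_left₀ (Finset.sum_nonneg fun _ _ => sq_nonneg _)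
          (sum_eta_sq_le N n hn k u (Finset.mem_range.1 hu)) 2
    _ = _ := by simp; ring

lemma sum1_le (n : ℕ → ℕ) (k : ℕ) :
    (∑ u ∈ Finset.range (csum n k), ∑ i ∈ Finset.range u,
            ∑ j ∈ (Finset.range u).filter (fun j => j ≠ i),
              (eta n k i u) ^ 2 * (eta n k j u) ^ 2) ≤
    ∑ u ∈ Finset.range (csum n k), (∑ i ∈ Finset.range (csum n k), eta n k i u ^ 2) ^ 2 := by
  apply Finset.sum_le_sum
  intro u hu
  have hs : Finset.range u ⊆ Finset.range (csum n k) :=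
    Finset.range_subset_range.2 (Finset.mem_range.1 hu).le
  rw [pow_two (∑ i ∈ Finset.range (csum n k), eta n k i u ^ 2), Finset.sum_mul_sum]
  calc _ ≤ ∑ i ∈ Finset.range u, ∑ j ∈ Finset.range (csum n k),
        (eta n k i u) ^ 2 * (eta n k j u) ^ 2 := by
        apply Finset.sum_le_sum
        intro i _
        apply Finset.sum_le_sum_of_subset_of_nonneg ((Finset.filter_subset _ _).trans hs)
        intros; positivity
    _ ≤ _ := by
        apply Finset.sum_le_sum_of_subset_of_nonneg hs
        intros; positivity

lemma sum2_le (n : ℕ → ℕ) (k : ℕ) :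
    (∑ i ∈ Finset.range (csum n k),
              ∑ j ∈ (Finset.range (csum n k)).filter (fun j => j ≠ i),
                (eta n k i j) ^ 4) ≤
    ∑ u ∈ Finset.range (csum n k), (∑ i ∈ Finset.range (csum n k), eta n k i u ^ 2) ^ 2 := by
  apply Finset.sum_le_sum
  intro u hu
  calc _ ≤ ∑ j ∈ Finset.range (csum n k), (eta n k u j) ^ 4 := by
        apply Finset.sum_le_sum_of_subset_of_nonneg (Finset.filter_subset _ _)
        intros; positivity
    _ = ∑ j ∈ Finset.range (csum n k), (eta n k j u ^ 2) ^ 2 := by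
        apply Finset.sum_congr rfl
        intro j _
        rw [eta_comm]; ring
    _ ≤ _ := Finset.sum_sq_le_sq_sum_of_nonneg fun _ _ => sq_nonneg _

lemma Mwt_ge (N : ℕ) (hN : 2 ≤ N) (n : ℕ → ℕ) (hn : ∀ i, 2 ≤ n i ∧ n i ≤ N) (k : ℕ)
    (hk : 2 * N ≤ k) : (csum n k : ℝ) ^ 3 / (4 * (N : ℝ) ^ 3) ≤ Mwt n k := by
  have hn2 : ∀ i, 2 ≤ n i := fun i => (hn i).1
  have hmono := csum_strictMono n hn2
  have hNpos : (0 : ℝ) < N := by exact_mod_cast (by omega : 0 < N)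
  have hbig : (2 * N : ℝ) ≤ csum n k := by exact_mod_cast hk.trans (csum_ge n hn2 k)
  have hkN : (csum n k : ℝ) ≤ k * N := by exact_mod_cast csum_le N n (fun i => (hn i).2) k
  have hterm : ∀ i ∈ Finset.range k, ((csum n k : ℝ) / (2 * N)) ^ 2 ≤
      ∑ s ∈ (Finset.range (csum n k)).filter (fun s => csum n i < s),
        (eta n k (csum n i) s) ^ 2 := by
    intro i hi
    have hi := Finset.mem_range.1 hi
    have h2 := hn2 i
    have hs := csum_succ n i
    have hle : csum n (i + 1) ≤ csum n k := hmono.monotone hi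
    have e1 : trt n (csum n i) = i := trt_eq n hn2 _ _ le_rfl (by omega)
    have e2 : trt n (csum n i + 1) = i := trt_eq n hn2 _ _ (by omega) (by omega)
    have hm : csum n i + 1 ∈ (Finset.range (csum n k)).filter (fun s => csum n i < s) := by
      rw [Finset.mem_filter, Finset.mem_range]; omega
    refine le_trans ?_ (Finset.single_le_sum
      (f := fun s => (eta n k (csum n i) s) ^ 2) (fun _ _ => sq_nonneg _) hm)
    simp only [eta, e1, e2, if_true]
    apply pow_le_pow_left₀ (by positivity)
    have h2' : (2 : ℝ) ≤ n i := by exact_mod_cast h2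
    have hN' : (n i : ℝ) ≤ N := by exact_mod_cast (hn i).2
    rw [div_le_div_iff₀ (by positivity) (by linarith)]
    nlinarith
  calc (csum n k : ℝ) ^ 3 / (4 * (N : ℝ) ^ 3)
      = (csum n k / N : ℝ) * ((csum n k : ℝ) / (2 * N)) ^ 2 := by field_simp; ring
    _ ≤ k * ((csum n k : ℝ) / (2 * N)) ^ 2 := by
        apply mul_le_mul_of_nonneg_right _ (sq_nonneg _)
        rwa [div_le_iff₀ hNpos]
    _ = ∑ i ∈ Finset.range k, ((csum n k : ℝ) / (2 * N)) ^ 2 := by simp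
    _ ≤ _ := Finset.sum_le_sum hterm
    _ = ∑ r ∈ (Finset.range k).image (csum n),
          ∑ s ∈ (Finset.range (csum n k)).filter (fun s => r < s), (eta n k r s) ^ 2 := by
        rw [Finset.sum_image (fun a _ b _ h => hmono.injective h)]
    _ ≤ Mwt n k := by
        apply Finset.sum_le_sum_of_subset_of_nonneg
        · intro r hr
          obtain ⟨i, hi, rfl⟩ := Finset.mem_image.1 hr
          exact Finset.mem_range.2 (hmono (Finset.mem_range.1 hi))
        · intro _ _ _
          exact Finset.sum_nonneg fun _ _ => sq_nonneg _

lemma tendsto_aux (N : ℕ) (hN : 2 ≤ N) (n : ℕ → ℕ) (hn : ∀ i, 2 ≤ n i ∧ n i ≤ N)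
    (f : ℕ → ℝ) (h0 : ∀ k, 0 ≤ f k)
    (h1 : ∀ k, f k ≤ ((N : ℝ) + 1) ^ 2 * (csum n k : ℝ) ^ 5) :
    Tendsto (fun k => f k / (Mwt n k) ^ 2) atTop (𝓝 0) := by
  have hn2 : ∀ i, 2 ≤ n i := fun i => (hn i).1
  have hNpos : (0 : ℝ) < N := by exact_mod_cast (by omega : 0 < N)
  have hlim : Tendsto (fun k : ℕ => (((N : ℝ) + 1) ^ 2 * (16 * (N : ℝ) ^ 6)) / (k : ℝ))
      atTop (𝓝 0) := tendsto_const_div_atTop_nhds_zero_nat _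
  refine tendsto_of_tendsto_of_tendsto_of_le_of_le' tendsto_const_nhds hlim
    (Eventually.of_forall fun k => div_nonneg (h0 k) (sq_nonneg _)) ?_
  filter_upwards [eventually_ge_atTop (2 * N)] with k hk
  have hkpos : (0 : ℝ) < k := by exact_mod_cast (by omega : 0 < k)
  have hck : (k : ℝ) ≤ csum n k := by exact_mod_cast csum_ge n hn2 k
  have hcpos : (0 : ℝ) < csum n k := by linarith
  have hM := Mwt_ge N hN n hn k hk
  calc f k / (Mwt n k) ^ 2
      ≤ (((N : ℝ) + 1) ^ 2 * (csum n k : ℝ) ^ 5) /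
          ((csum n k : ℝ) ^ 3 / (4 * (N : ℝ) ^ 3)) ^ 2 := by
        apply div_le_div₀ (by positivity) (h1 k) (by positivity)
        exact pow_le_pow_left₀ (by positivity) hM 2
    _ = (((N : ℝ) + 1) ^ 2 * (16 * (N : ℝ) ^ 6)) / (csum n k : ℝ) := by
        field_simp; ring
    _ ≤ _ := by
        apply div_le_div_of_nonneg_left (by positivity) hkpos hck

/-- Lemma A.2: for bounded treatment sizes `2 ≤ n_i ≤ N`, the design
weights satisfy, as `k → ∞`,
`Σ_{i≠j<u} η_{iu}² η_{ju}² / M_n² → 0` and `Σ_{i≠j} η_{ij}⁴ / M_n² → 0`. -/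
theorem eta_negligibility (N : ℕ) (hN : 2 ≤ N) (n : ℕ → ℕ)
    (hn : ∀ i, 2 ≤ n i ∧ n i ≤ N) :
    Tendsto (fun k =>
        (∑ u ∈ Finset.range (csum n k), ∑ i ∈ Finset.range u,
            ∑ j ∈ (Finset.range u).filter (fun j => j ≠ i),
              (eta n k i u) ^ 2 * (eta n k j u) ^ 2) / (Mwt n k) ^ 2)
      atTop (𝓝 0)
      ∧ Tendsto (fun k =>
          (∑ i ∈ Finset.range (csum n k),
              ∑ j ∈ (Finset.range (csum n k)).filter (fun j => j ≠ i),
                (eta n k i j) ^ 4) / (Mwt n k) ^ 2)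
        atTop (𝓝 0) := by
  constructor
  · apply tendsto_aux N hN n hn
    · intro k
      exact Finset.sum_nonneg fun _ _ => Finset.sum_nonneg fun _ _ =>
        Finset.sum_nonneg fun _ _ => by positivity
    · intro k
      exact (sum1_le n k).trans (sum_sq_sum_le N n hn k)
  · apply tendsto_aux N hN n hn
    · intro k
      exact Finset.sum_nonneg fun _ _ => Finset.sum_nonneg fun _ _ => by positivity
    · intro k
      exact (sum2_le n k).trans (sum_sq_sum_le N n hn k)
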